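/- For every n ≥ 1, the grid net G_n has a pure wiring decomposition of width n, i.e. a wiring decomposition of width n in which every ';'-composition occurring in the expression is pure. -/

import Mathlib

/-! Core definitions: nets with boundaries (Sobocinski et al.),
composition, tensor, isomorphism, step firing semantics, ports,
connections, networks, bases, wiring expressions and decompositions. -/

namespace NWB

/-- A net with boundaries `N : k → l` (without the contention axioms,
which are packaged separately in `IsContention`). -/
structure NetB (k l : ℕ) : Type 1 where
  P : Type
  T : Type
  finP : Finite P
  finT : Finite T
  pre : T → Set P
  post : T → Set P
  src : T → Set (Fin k)
  tgt : T → Set (Fin l)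
  con : T → T → Prop

/-- The contention relation axioms: reflexive, symmetric, and forced whenever
two transitions share a pre-place, post-place, or boundary port. -/
def IsContention {k l : ℕ} (N : NetB k l) : Prop :=
  (∀ t, N.con t t) ∧ (∀ t u, N.con t u → N.con u t) ∧
  (∀ t u,
    ((N.pre t ∩ N.pre u).Nonempty ∨ (N.post t ∩ N.post u).Nonempty ∨
     (N.src t ∩ N.src u).Nonempty ∨ (N.tgt t ∩ N.tgt u).Nonempty) → N.con t u)

def setPre {k l : ℕ} (N : NetB k l) (U : Set N.T) : Set N.P := ⋃ u ∈ U, N.pre u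
def setPost {k l : ℕ} (N : NetB k l) (U : Set N.T) : Set N.P := ⋃ u ∈ U, N.post u
def setSrc {k l : ℕ} (N : NetB k l) (U : Set N.T) : Set (Fin k) := ⋃ u ∈ U, N.src u
def setTgt {k l : ℕ} (N : NetB k l) (U : Set N.T) : Set (Fin l) := ⋃ u ∈ U, N.tgt u

/-- Mutually independent set of transitions: no two distinct members in contention. -/
def MI {k l : ℕ} (N : NetB k l) (U : Set N.T) : Prop :=
  ∀ u ∈ U, ∀ v ∈ U, N.con u v → u = v

/-- Contention lifted to sets of transitions. -/
def setCon {k l : ℕ} (N : NetB k l) (U V : Set N.T) : Prop :=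
  ∃ u ∈ U, ∃ v ∈ V, N.con u v

/-- A synchronisation between `M : l → m` and `N : m → n`. -/
structure Sync {l m n : ℕ} (M : NetB l m) (N : NetB m n) where
  U : Set M.T
  V : Set N.T
  miU : MI M U
  miV : MI N V
  bd : setTgt M U = setSrc N V

def Sync.Trivial {l m n : ℕ} {M : NetB l m} {N : NetB m n} (s : Sync M N) : Prop :=
  s.U = ∅ ∧ s.V = ∅

/-- A minimal synchronisation: non-trivial, and every componentwise-smaller
synchronisation is trivial or equal to it. -/
def Sync.Minimal {l m n : ℕ} {M : NetB l m} {N : NetB m n} (s : Sync M N) : Prop :=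
  ¬ s.Trivial ∧
  ∀ s' : Sync M N, s'.U ⊆ s.U → s'.V ⊆ s.V → (s'.Trivial ∨ (s'.U = s.U ∧ s'.V = s.V))

theorem sync_finite {l m n : ℕ} (M : NetB l m) (N : NetB m n) : Finite (Sync M N) := by
  haveI := M.finT; haveI := N.finT
  apply Finite.of_injective (fun s : Sync M N => (s.U, s.V))
  intro s s' h
  simp only [Prod.mk.injEq] at h
  obtain ⟨h1, h2⟩ := h
  cases s; cases s'
  simp_all

/-- Composition along a common boundary. -/
def comp {l m n : ℕ} (M : NetB l m) (N : NetB m n) : NetB l n where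
  P := M.P ⊕ N.P
  T := {s : Sync M N // s.Minimal}
  finP := by haveI := M.finP; haveI := N.finP; exact inferInstance
  finT := by haveI := sync_finite M N; exact inferInstance
  pre s := (Sum.inl '' setPre M s.1.U) ∪ (Sum.inr '' setPre N s.1.V)
  post s := (Sum.inl '' setPost M s.1.U) ∪ (Sum.inr '' setPost N s.1.V)
  src s := setSrc M s.1.U
  tgt s := setTgt N s.1.V
  con s s' := setCon M s.1.U s'.1.U ∨ setCon N s.1.V s'.1.V

/-- Tensor product of nets with boundaries. -/
def tensor {l m k n : ℕ} (M : NetB l m) (N : NetB k n) : NetB (l + k) (m + n) where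
  P := M.P ⊕ N.P
  T := M.T ⊕ N.T
  finP := by haveI := M.finP; haveI := N.finP; exact inferInstance
  finT := by haveI := M.finT; haveI := N.finT; exact inferInstance
  pre t := match t with
    | Sum.inl t => Sum.inl '' M.pre t
    | Sum.inr t => Sum.inr '' N.pre t
  post t := match t with
    | Sum.inl t => Sum.inl '' M.post t
    | Sum.inr t => Sum.inr '' N.post t
  src t := match t with
    | Sum.inl t => Fin.castAdd k '' M.src t
    | Sum.inr t => Fin.natAdd l '' N.src t
  tgt t := match t with
    | Sum.inl t => Fin.castAdd n '' M.tgt t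
    | Sum.inr t => Fin.natAdd m '' N.tgt t
  con t u := match t, u with
    | Sum.inl t, Sum.inl u => M.con t u
    | Sum.inr t, Sum.inr u => N.con t u
    | _, _ => False

/-- Isomorphism of nets with boundaries: bijections on places and transitions
preserving pre-sets, post-sets, boundary maps and contention. -/
structure NetIso {k l : ℕ} (M N : NetB k l) where
  ep : M.P ≃ N.P
  et : M.T ≃ N.T
  pre_eq : ∀ t, N.pre (et t) = ep '' M.pre t
  post_eq : ∀ t, N.post (et t) = ep '' M.post t
  src_eq : ∀ t, N.src (et t) = M.src t
  tgt_eq : ∀ t, N.tgt (et t) = M.tgt t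
  con_iff : ∀ t u, N.con (et t) (et u) ↔ M.con t u

def Iso {k l : ℕ} (M N : NetB k l) : Prop := Nonempty (NetIso M N)

/-- Transport a net along equalities of its boundary sizes. -/
def castNet {k l k' l' : ℕ} (h1 : k = k') (h2 : l = l') (N : NetB k l) : NetB k' l' where
  P := N.P
  T := N.T
  finP := N.finP
  finT := N.finT
  pre := N.pre
  post := N.post
  src t := Fin.cast h1 '' N.src t
  tgt t := Fin.cast h2 '' N.tgt t
  con := N.con

def emptyNet : NetB 0 0 where
  P := Empty
  T := Empty
  finP := inferInstance
  finT := inferInstance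
  pre t := t.elim
  post t := t.elim
  src t := t.elim
  tgt t := t.elim
  con t _ := t.elim

/-- The step firing semantics: `Fires N X X' α β` iff the LTS `⟦N⟧` has a
transition `X →⟨α,β⟩ X'`. -/
def Fires {k l : ℕ} (N : NetB k l) (X X' : Set N.P) (α : Set (Fin k)) (β : Set (Fin l)) :
    Prop :=
  ∃ U : Set N.T, MI N U ∧ setPre N U ⊆ X ∧ setPost N U ∩ X = ∅ ∧
    X' = (X \ setPre N U) ∪ setPost N U ∧ setSrc N U = α ∧ setTgt N U = β

/-! ### Ports, connections and networks -/

/-- The ports of a net: an in-port and an out-port for each place,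
together with the left and right boundary ports. -/
def Port {k l : ℕ} (N : NetB k l) : Type := (N.P ⊕ N.P) ⊕ (Fin k ⊕ Fin l)

def portIn {k l : ℕ} {N : NetB k l} (p : N.P) : Port N := Sum.inl (Sum.inl p)
def portOut {k l : ℕ} {N : NetB k l} (p : N.P) : Port N := Sum.inl (Sum.inr p)
def bLeft {k l : ℕ} {N : NetB k l} (i : Fin k) : Port N := Sum.inr (Sum.inl i)
def bRight {k l : ℕ} {N : NetB k l} (j : Fin l) : Port N := Sum.inr (Sum.inr j)

/-- The portset of a transition. -/
def tports {k l : ℕ} (N : NetB k l) (t : N.T) : Set (Port N) :=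
  (portOut '' N.pre t) ∪ (portIn '' N.post t) ∪ (bLeft '' N.src t) ∪ (bRight '' N.tgt t)

/-- The connection of a port `q`: the portsets (minus `q`) of all transitions
properly connecting to `q`. -/
def conn {k l : ℕ} (N : NetB k l) (q : Port N) : Set (Set (Port N)) :=
  { K | ∃ t : N.T, {q} ⊂ tports N t ∧ K = tports N t \ {q} }

/-- The connection of `q` restricted to a set `R` of ports. -/
def connR {k l : ℕ} (N : NetB k l) (R : Set (Port N)) (q : Port N) :
    Set (Set (Port N)) :=
  { K' | ∃ K ∈ conn N q, (K ∩ R).Nonempty ∧ K' = K ∩ R }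

/-- Extended ports of the left part of an oriented partition. -/
def eportsL {k l : ℕ} (N : NetB k l) (Pl : Set N.P) : Set (Port N) :=
  (portIn '' Pl) ∪ (portOut '' Pl) ∪ Set.range (bLeft (N := N))

/-- Extended ports of the right part of an oriented partition. -/
def eportsR {k l : ℕ} (N : NetB k l) (Pr : Set N.P) : Set (Port N) :=
  (portIn '' Pr) ∪ (portOut '' Pr) ∪ Set.range (bRight (N := N))

/-- The network `net(P_l → P_r)`. -/
def networkLR {k l : ℕ} (N : NetB k l) (Pl Pr : Set N.P) :
    Set (Set (Set (Port N))) :=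
  { c | ∃ q ∈ eportsL N Pl, c = connR N (eportsR N Pr) q }

/-- The network `net(P_r → P_l)`. -/
def networkRL {k l : ℕ} (N : NetB k l) (Pl Pr : Set N.P) :
    Set (Set (Set (Port N))) :=
  { c | ∃ q ∈ eportsR N Pr, c = connR N (eportsL N Pl) q }

/-- `b` is a basis of the network `M`: every connection in `M` is a union of
basis connections. -/
def IsBasis {C : Type} {m : ℕ} (b : Fin m → Set C) (M : Set (Set C)) : Prop :=
  ∀ c ∈ M, ∃ S : Finset (Fin m), c = ⋃ i ∈ S, b i

/-- The dimension of a network: the size of its smallest basis. -/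
noncomputable def netDim {C : Type} (M : Set (Set C)) : ℕ :=
  sInf { m | ∃ b : Fin m → Set C, IsBasis b M }

/-- Purity of a composition `N_l ; N_r`: no transition of either component
connects to two different shared boundary ports. -/
def Pure {k n l : ℕ} (Nl : NetB k n) (Nr : NetB n l) : Prop :=
  (∀ j : Fin n, ∀ K ∈ conn Nl (bRight j), ∀ i : Fin n, bRight i ∉ K) ∧
  (∀ j : Fin n, ∀ K ∈ conn Nr (bLeft j), ∀ i : Fin n, bLeft i ∉ K)

/-! ### Wiring expressions and decompositions -/

/-- Nets with boundaries of arbitrary boundary sizes. -/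
def NetS : Type 1 := Σ (k : ℕ) (l : ℕ), NetB k l

/-- Composition on `NetS` (junk value on boundary mismatch). -/
def seqS (X Y : NetS) : NetS :=
  if h : X.2.1 = Y.1 then ⟨X.1, Y.2.1, comp (castNet rfl h X.2.2) Y.2.2⟩
  else ⟨0, 0, emptyNet⟩

def tenS (X Y : NetS) : NetS := ⟨X.1 + Y.1, X.2.1 + Y.2.1, tensor X.2.2 Y.2.2⟩

/-- Wiring expressions: binary trees with `;` and `⊗` nodes and variables at
the leaves. -/
inductive WExpr (V : Type) : Type
  | leaf : V → WExpr V
  | seq : WExpr V → WExpr V → WExpr V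
  | ten : WExpr V → WExpr V → WExpr V

/-- Semantics of a wiring expression under a variable assignment. -/
def sem {V : Type} (A : V → NetS) : WExpr V → NetS
  | .leaf x => A x
  | .seq t₁ t₂ => seqS (sem A t₁) (sem A t₂)
  | .ten t₁ t₂ => tenS (sem A t₁) (sem A t₂)

/-- Compatibility of an assignment with an expression: at each `;` node the
shared boundaries match. -/
def WT {V : Type} (A : V → NetS) : WExpr V → Prop
  | .leaf _ => True
  | .seq t₁ t₂ => WT A t₁ ∧ WT A t₂ ∧ (sem A t₁).2.1 = (sem A t₂).1
  | .ten t₁ t₂ => WT A t₁ ∧ WT A t₂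

/-- The wiring decomposition `(t, A)` has width `w`: every leaf net has
boundaries and number of places `≤ w`, and every subexpression has
boundaries `≤ w`. -/
def HasWidth {V : Type} (A : V → NetS) (w : ℕ) : WExpr V → Prop
  | .leaf x => (A x).1 ≤ w ∧ Nat.card (A x).2.2.P ≤ w ∧ (A x).2.1 ≤ w
  | .seq t₁ t₂ => HasWidth A w t₁ ∧ HasWidth A w t₂ ∧
      (sem A (.seq t₁ t₂)).1 ≤ w ∧ (sem A (.seq t₁ t₂)).2.1 ≤ w
  | .ten t₁ t₂ => HasWidth A w t₁ ∧ HasWidth A w t₂ ∧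
      (sem A (.ten t₁ t₂)).1 ≤ w ∧ (sem A (.ten t₁ t₂)).2.1 ≤ w

/-- `(t, A)` is a wiring decomposition of `N : k → l`: the assignment maps
variables to genuine nets with boundaries, is compatible with `t`, and
`⟦t⟧_A ≅ N`. -/
def IsDecompOf {V : Type} {k l : ℕ} (A : V → NetS) (t : WExpr V) (N : NetB k l) : Prop :=
  (∀ x, IsContention (A x).2.2) ∧ WT A t ∧
  ∃ (h1 : (sem A t).1 = k) (h2 : (sem A t).2.1 = l),
    Iso (castNet h1 h2 (sem A t).2.2) N

/-- A net has decomposition width `w` if it has a wiring decomposition of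
width `w`. -/
def HasDecompWidth {k l : ℕ} (N : NetB k l) (w : ℕ) : Prop :=
  ∃ (Var : Type) (A : Var → NetS) (t : WExpr Var),
    IsDecompOf A t N ∧ HasWidth A w t

/-- A pure wiring decomposition: at every `;` node the composition of the two
subexpression nets is pure. -/
def PureExpr {V : Type} (A : V → NetS) : WExpr V → Prop
  | .leaf _ => True
  | .seq t₁ t₂ => PureExpr A t₁ ∧ PureExpr A t₂ ∧
      ∀ (h : (sem A t₁).2.1 = (sem A t₂).1),
        Pure (castNet rfl h (sem A t₁).2.2) (sem A t₂).2.2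
  | .ten t₁ t₂ => PureExpr A t₁ ∧ PureExpr A t₂

/-- One step of reassociation of `;` or `⊗`, anywhere inside an expression. -/
inductive AssocStep {V : Type} : WExpr V → WExpr V → Prop
  | seqAssoc (a b c : WExpr V) : AssocStep (.seq (.seq a b) c) (.seq a (.seq b c))
  | tenAssoc (a b c : WExpr V) : AssocStep (.ten (.ten a b) c) (.ten a (.ten b c))
  | seqCongrL {a a' : WExpr V} (b : WExpr V) :
      AssocStep a a' → AssocStep (.seq a b) (.seq a' b)
  | seqCongrR (a : WExpr V) {b b' : WExpr V} :
      AssocStep b b' → AssocStep (.seq a b) (.seq a b')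
  | tenCongrL {a a' : WExpr V} (b : WExpr V) :
      AssocStep a a' → AssocStep (.ten a b) (.ten a' b)
  | tenCongrR (a : WExpr V) {b b' : WExpr V} :
      AssocStep b b' → AssocStep (.ten a b) (.ten a b')

/-- Equivalence of wiring expressions up to associativity of `;` and `⊗`. -/
def AssocEquiv {V : Type} : WExpr V → WExpr V → Prop := Relation.EqvGen AssocStep

/-! ### Concrete families of nets -/

/-- The clique net `C_n : 0 → 0`, with the minimal contention relation. -/
def clique (n : ℕ) : NetB 0 0 where
  P := Fin n
  T := {p : Fin n × Fin n // p.1 ≠ p.2}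
  finP := inferInstance
  finT := inferInstance
  pre t := {t.1.1}
  post t := {t.1.2}
  src _ := ∅
  tgt _ := ∅
  con t u := t.1.1 = u.1.1 ∨ t.1.2 = u.1.2

/-- The subset net `P_n : 0 → 0`: a place `S` (= `none`), places `[n]`, and for
each `A ⊆ [n]` a transition `S → A`; the minimal contention relation is total
since all pre-sets are `{S}`. -/
def subsetNet (n : ℕ) : NetB 0 0 where
  P := Option (Fin n)
  T := Set (Fin n)
  finP := inferInstance
  finT := inferInstance
  pre _ := {none}
  post A := some '' A
  src _ := ∅
  tgt _ := ∅
  con _ _ := True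

/-- The tree net `T_Δ^{n,k} : 0 → 0`: places are nodes of the complete n-ary
tree of depth k (lists over `Fin n` of length ≤ k); each non-leaf node has a
single transition to the set of its n children. The minimal contention
relation is equality. -/
def treeD (n k : ℕ) : NetB 0 0 where
  P := {l : List (Fin n) // l.length ≤ k}
  T := {l : List (Fin n) // l.length < k}
  finP := (List.finite_length_le (Fin n) k).to_subtype
  finT := (List.finite_length_lt (Fin n) k).to_subtype
  pre t := {⟨t.1, t.2.le⟩}
  post t := {p | ∃ i : Fin n, p.1 = t.1 ++ [i]}
  src _ := ∅
  tgt _ := ∅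
  con t u := t = u

/-- The tree net `T_Λ^{n,k} : 0 → 0`: as `T_Δ^{n,k}` but with a separate
transition from each non-leaf node to each of its children. The minimal
contention relation relates transitions with the same parent node. -/
def treeL (n k : ℕ) : NetB 0 0 where
  P := {l : List (Fin n) // l.length ≤ k}
  T := {l : List (Fin n) // l.length < k} × Fin n
  finP := (List.finite_length_le (Fin n) k).to_subtype
  finT := by
    haveI : Finite {l : List (Fin n) // l.length < k} :=
      (List.finite_length_lt (Fin n) k).to_subtype
    exact inferInstance
  pre t := {⟨t.1.1, t.1.2.le⟩}
  post t := {p | p.1 = t.1.1 ++ [t.2]}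
  src _ := ∅
  tgt _ := ∅
  con t u := t.1 = u.1

/-- The grid net `G_n : 0 → 0`: places `[n] × [n]`, a transition from each
place to its right neighbour and to its lower neighbour; the minimal
contention relation relates transitions sharing a pre-place or post-place. -/
def grid (n : ℕ) : NetB 0 0 where
  P := Fin n × Fin n
  T := {e : (Fin n × Fin n) × (Fin n × Fin n) //
        (e.2.1 = e.1.1 ∧ (e.2.2 : ℕ) = (e.1.2 : ℕ) + 1) ∨
        ((e.2.1 : ℕ) = (e.1.1 : ℕ) + 1 ∧ e.2.2 = e.1.2)}
  finP := inferInstance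
  finT := inferInstance
  pre e := {e.1.1}
  post e := {e.1.2}
  src _ := ∅
  tgt _ := ∅
  con t u := t.1.1 = u.1.1 ∨ t.1.2 = u.1.2

end NWB

namespace NWB

abbrev Pt := ℕ × ℕ
abbrev Edge := Pt × Pt

/-- Two edges share a source or a target. -/
def Share (e f : Edge) : Prop := e.1 = f.1 ∨ e.2 = f.2

/-- A net whose places and transitions are faithfully coded by points and edges in the plane. -/
structure Coded {k l : ℕ} (N : NetB k l) (PS : Set Pt) (E : Set Edge) (a b : ℕ) where
  ep : N.P → Pt
  et : N.T → Edge
  ep_inj : Function.Injective ep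
  et_inj : Function.Injective et
  ep_range : Set.range ep = PS
  et_range : Set.range et = E
  pre_iff : ∀ t p, p ∈ N.pre t ↔ ep p = (et t).1
  post_iff : ∀ t p, p ∈ N.post t ↔ ep p = (et t).2
  src_iff : ∀ t (i : Fin k), i ∈ N.src t ↔ (et t).1 = (a, (i : ℕ))
  tgt_iff : ∀ t (i : Fin l), i ∈ N.tgt t ↔ (et t).2 = (b, (i : ℕ))
  con_iff : ∀ t u, N.con t u ↔ Share (et t) (et u)

section CodedBasics

variable {k l : ℕ} {N : NetB k l} {PS : Set Pt} {E : Set Edge} {a b : ℕ}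

theorem Coded.memE (c : Coded N PS E a b) (t : N.T) : c.et t ∈ E :=
  c.et_range.subset ⟨t, rfl⟩

theorem Coded.exE (c : Coded N PS E a b) {e : Edge} (h : e ∈ E) : ∃ t, c.et t = e :=
  c.et_range.symm.subset h

theorem Coded.memP (c : Coded N PS E a b) (p : N.P) : c.ep p ∈ PS :=
  c.ep_range.subset ⟨p, rfl⟩

theorem Coded.exP (c : Coded N PS E a b) {p : Pt} (h : p ∈ PS) : ∃ q, c.ep q = p :=
  c.ep_range.symm.subset h

end CodedBasics

theorem bRight_mem_tports {k l : ℕ} {N : NetB k l} {t : N.T} {j : Fin l} :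
    bRight j ∈ tports N t ↔ j ∈ N.tgt t := by
  constructor
  · rintro (((⟨x, _, h⟩ | ⟨x, _, h⟩) | ⟨x, _, h⟩) | ⟨x, hx, h⟩)
    · cases h
    · cases h
    · cases h
    · cases h; exact hx
  · intro h; exact Or.inr ⟨j, h, rfl⟩

theorem bLeft_mem_tports {k l : ℕ} {N : NetB k l} {t : N.T} {j : Fin k} :
    bLeft j ∈ tports N t ↔ j ∈ N.src t := by
  constructor
  · rintro (((⟨x, _, h⟩ | ⟨x, _, h⟩) | ⟨x, hx, h⟩) | ⟨x, _, h⟩)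
    · cases h
    · cases h
    · cases h; exact hx
    · cases h
  · intro h; exact Or.inl (Or.inr ⟨j, h, rfl⟩)

/-- The canonical coded net. -/
def codeNet (k l : ℕ) (PS : Set Pt) (E : Set Edge) (hP : PS.Finite) (hE : E.Finite)
    (a b : ℕ) : NetB k l where
  P := PS
  T := E
  finP := hP
  finT := hE
  pre t := {p | p.1 = t.1.1}
  post t := {p | p.1 = t.1.2}
  src t := {i | t.1.1 = (a, (i : ℕ))}
  tgt t := {i | t.1.2 = (b, (i : ℕ))}
  con t u := Share t.1 u.1

def codeNet_coded (k l : ℕ) (PS : Set Pt) (E : Set Edge) (hP : PS.Finite) (hE : E.Finite)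
    (a b : ℕ) : Coded (codeNet k l PS E hP hE a b) PS E a b where
  ep := Subtype.val
  et := Subtype.val
  ep_inj := Subtype.val_injective
  et_inj := Subtype.val_injective
  ep_range := Subtype.range_coe
  et_range := Subtype.range_coe
  pre_iff _ _ := Iff.rfl
  post_iff _ _ := Iff.rfl
  src_iff _ _ := Iff.rfl
  tgt_iff _ _ := Iff.rfl
  con_iff _ _ := Iff.rfl

theorem Coded.isContention {k l : ℕ} {N : NetB k l} {PS : Set Pt} {E : Set Edge} {a b : ℕ}
    (c : Coded N PS E a b) : IsContention N := by
  refine ⟨fun t => (c.con_iff _ _).2 (Or.inl rfl), fun t u h => ?_, fun t u h => ?_⟩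
  · rw [c.con_iff] at h ⊢
    exact h.imp Eq.symm Eq.symm
  · rw [c.con_iff]
    rcases h with ⟨p, h1, h2⟩ | ⟨p, h1, h2⟩ | ⟨p, h1, h2⟩ | ⟨p, h1, h2⟩
    · rw [c.pre_iff] at h1 h2
      exact Or.inl (h1.symm.trans h2)
    · rw [c.post_iff] at h1 h2
      exact Or.inr (h1.symm.trans h2)
    · rw [c.src_iff] at h1 h2
      exact Or.inl (h1.trans h2.symm)
    · rw [c.tgt_iff] at h1 h2
      exact Or.inr (h1.trans h2.symm)

theorem Coded.pure {k m l : ℕ} {M : NetB k m} {N : NetB m l} {PS PS' : Set Pt}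
    {E E' : Set Edge} {a b a' b' : ℕ}
    (c : Coded M PS E a b) (d : Coded N PS' E' a' b') : Pure M N := by
  constructor
  · rintro j K ⟨t, h1, rfl⟩ i ⟨h2, h3⟩
    have hj : bRight j ∈ tports M t := h1.1 rfl
    rw [bRight_mem_tports] at h2 hj
    rw [c.tgt_iff] at h2 hj
    apply h3
    have : i = j := by
      apply Fin.ext
      have := h2.symm.trans hj
      simpa using this
    rw [this]; rfl
  · rintro j K ⟨t, h1, rfl⟩ i ⟨h2, h3⟩
    have hj : bLeft j ∈ tports N t := h1.1 rfl
    rw [bLeft_mem_tports] at h2 hj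
    rw [d.src_iff] at h2 hj
    apply h3
    have : i = j := by
      apply Fin.ext
      have := h2.symm.trans hj
      simpa using this
    rw [this]; rfl

theorem Coded.iso {k l : ℕ} {M N : NetB k l} {PS : Set Pt} {E : Set Edge} {a b : ℕ}
    (c : Coded M PS E a b) (d : Coded N PS E a b) : Iso M N := by
  have hp : ∀ p : M.P, ∃ q : N.P, d.ep q = c.ep p := fun p => d.exP (c.memP p)
  have ht : ∀ p : M.T, ∃ q : N.T, d.et q = c.et p := fun p => d.exE (c.memE p)
  choose f hf using hp
  choose g hg using ht
  have fb : Function.Bijective f := by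
    refine ⟨fun p q h => c.ep_inj (by rw [← hf, ← hf, h]), fun q => ?_⟩
    obtain ⟨p, h⟩ := c.exP (d.memP q)
    exact ⟨p, d.ep_inj (by rw [hf, h])⟩
  have gb : Function.Bijective g := by
    refine ⟨fun p q h => c.et_inj (by rw [← hg, ← hg, h]), fun q => ?_⟩
    obtain ⟨p, h⟩ := c.exE (d.memE q)
    exact ⟨p, d.et_inj (by rw [hg, h])⟩
  refine ⟨⟨Equiv.ofBijective f fb, Equiv.ofBijective g gb, ?_, ?_, ?_, ?_, ?_⟩⟩
  · intro t
    ext q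
    obtain ⟨p, rfl⟩ := fb.2 q
    simp [d.pre_iff, c.pre_iff, fb.1.eq_iff, hf, hg]
  · intro t
    ext q
    obtain ⟨p, rfl⟩ := fb.2 q
    simp [d.post_iff, c.post_iff, fb.1.eq_iff, hf, hg]
  · intro t
    ext i
    simp [d.src_iff, c.src_iff, hg]
  · intro t
    ext i
    simp [d.tgt_iff, c.tgt_iff, hg]
  · intro t u
    simp [d.con_iff, c.con_iff, hg]

/-- `e` crosses the cut between rows `b` and `b+1`. -/
def Crossing (b : ℕ) (e : Edge) : Prop := e.1.1 = b ∧ e.2.1 = b + 1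

/-- The edges of a composite net. -/
def glueE (E1 E2 : Set Edge) (b : ℕ) : Set Edge :=
  {e | (e ∈ E1 ∨ e ∈ E2) ∧ (Crossing b e → e ∈ E1 ∧ e ∈ E2)}

section Glue

variable {l m n : ℕ} {M : NetB l m} {N : NetB m n} {P1 P2 : Set Pt} {E1 E2 : Set Edge}
  {a b c : ℕ}

/-- Geometric side conditions for gluing. -/
structure GlueOK (m : ℕ) (P1 P2 : Set Pt) (E1 E2 : Set Edge) (a b c : ℕ) : Prop where
  ha : a ≤ b
  hc : b + 1 ≤ c
  hP1 : ∀ p ∈ P1, p.1 ≤ b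
  hP2 : ∀ p ∈ P2, b + 1 ≤ p.1
  h1 : ∀ e ∈ E1, e.1.1 ≤ b ∧ (e.2.1 ≤ b ∨ (Crossing b e ∧ e.2.2 = e.1.2 ∧ e.2.2 < m))
  h2 : ∀ e ∈ E2, b + 1 ≤ e.2.1 ∧ (b + 1 ≤ e.1.1 ∨ (Crossing b e ∧ e.2.2 = e.1.2 ∧ e.2.2 < m))

/-- The synchronisation associated with an edge. -/
def edgeSync (cM : Coded M P1 E1 a (b + 1)) (cN : Coded N P2 E2 b c)
    (ok : GlueOK m P1 P2 E1 E2 a b c) (e : Edge) (he : e ∈ glueE E1 E2 b) : Sync M N where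
  U := {t | cM.et t = e}
  V := {u | cN.et u = e}
  miU := fun t ht u hu _ => cM.et_inj (ht.trans hu.symm)
  miV := fun t ht u hu _ => cN.et_inj (ht.trans hu.symm)
  bd := by
    ext i
    simp only [setTgt, setSrc, Set.mem_iUnion, Set.mem_ofPred_eq, exists_prop, cM.tgt_iff,
      cN.src_iff]
    constructor
    · rintro ⟨t, rfl, h⟩
      have hh := ok.h1 _ (cM.memE t)
      rcases hh.2 with h' | ⟨h', h3, h4⟩
      · rw [h] at h'; simp at h'
      · obtain ⟨u, hu⟩ := cN.exE (he.2 h').2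
        refine ⟨u, hu, ?_⟩
        rw [hu]
        refine Prod.ext h'.1 ?_
        rw [← h3, h]
    · rintro ⟨t, rfl, h⟩
      have hh := ok.h2 _ (cN.memE t)
      rcases hh.2 with h' | ⟨h', h3, h4⟩
      · rw [h] at h'; simp at h'
      · obtain ⟨u, hu⟩ := cM.exE (he.2 h').1
        refine ⟨u, hu, ?_⟩
        rw [hu]
        refine Prod.ext h'.2 ?_
        rw [h3, h]

theorem sync_ofU (cM : Coded M P1 E1 a (b + 1)) (cN : Coded N P2 E2 b c)
    (ok : GlueOK m P1 P2 E1 E2 a b c) (s : Sync M N) (t : M.T) (ht : t ∈ s.U) :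
    cM.et t ∈ glueE E1 E2 b ∧ {t' | cM.et t' = cM.et t} ⊆ s.U ∧
      {u | cN.et u = cM.et t} ⊆ s.V := by
  have key : Crossing b (cM.et t) → ∃ u ∈ s.V, cN.et u = cM.et t := by
    intro hx
    have hh := ok.h1 _ (cM.memE t)
    rcases hh.2 with h' | ⟨h', h3, h4⟩
    · have := hx.2; omega
    · have hmem : (⟨(cM.et t).2.2, h4⟩ : Fin m) ∈ setTgt M s.U := by
        simp only [setTgt, Set.mem_iUnion]
        exact ⟨t, ht, (cM.tgt_iff _ _).2 (Prod.ext h'.2 rfl)⟩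
      rw [s.bd] at hmem
      simp only [setSrc, Set.mem_iUnion] at hmem
      obtain ⟨u, hu, hs⟩ := hmem
      rw [cN.src_iff] at hs
      refine ⟨u, hu, ?_⟩
      rcases (ok.h2 _ (cN.memE u)).2 with g | ⟨g, g3, g4⟩
      · rw [hs] at g; simp at g
      · have e2 : (cN.et u).1.2 = (cM.et t).2.2 := by rw [hs]
        refine Prod.ext (Prod.ext ?_ ?_) (Prod.ext ?_ ?_)
        · rw [g.1, h'.1]
        · rw [e2, h3]
        · rw [g.2, h'.2]
        · rw [g3, e2]
  refine ⟨⟨Or.inl (cM.memE t), fun hx => ⟨cM.memE t, ?_⟩⟩, ?_, ?_⟩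
  · obtain ⟨u, _, hu⟩ := key hx
    rw [← hu]; exact cN.memE u
  · intro t' h
    rw [cM.et_inj h]; exact ht
  · intro u hu
    have hu : cN.et u = cM.et t := hu
    have hh := ok.h1 _ (cM.memE t)
    have gg := ok.h2 _ (cN.memE u)
    rw [hu] at gg
    rcases hh.2 with h' | ⟨h', h3, h4⟩
    · omega
    · obtain ⟨u', hu', he⟩ := key h'
      rw [cN.et_inj (hu.trans he.symm)]; exact hu'

theorem sync_ofV (cM : Coded M P1 E1 a (b + 1)) (cN : Coded N P2 E2 b c)
    (ok : GlueOK m P1 P2 E1 E2 a b c) (s : Sync M N) (t : N.T) (ht : t ∈ s.V) :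
    cN.et t ∈ glueE E1 E2 b ∧ {t' | cM.et t' = cN.et t} ⊆ s.U ∧
      {u | cN.et u = cN.et t} ⊆ s.V := by
  have key : Crossing b (cN.et t) → ∃ u ∈ s.U, cM.et u = cN.et t := by
    intro hx
    have hh := ok.h2 _ (cN.memE t)
    rcases hh.2 with h' | ⟨h', h3, h4⟩
    · have := hx.1; omega
    · have hmem : (⟨(cN.et t).2.2, h4⟩ : Fin m) ∈ setSrc N s.V := by
        simp only [setSrc, Set.mem_iUnion]
        exact ⟨t, ht, (cN.src_iff _ _).2 (Prod.ext h'.1 h3.symm)⟩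
      rw [← s.bd] at hmem
      simp only [setTgt, Set.mem_iUnion] at hmem
      obtain ⟨u, hu, hs⟩ := hmem
      rw [cM.tgt_iff] at hs
      refine ⟨u, hu, ?_⟩
      rcases (ok.h1 _ (cM.memE u)).2 with g | ⟨g, g3, g4⟩
      · rw [hs] at g; simp at g
      · have e2 : (cM.et u).2.2 = (cN.et t).2.2 := by rw [hs]
        refine Prod.ext (Prod.ext ?_ ?_) (Prod.ext ?_ ?_)
        · rw [g.1, h'.1]
        · rw [← g3, e2, h3]
        · rw [g.2, h'.2]
        · rw [e2]
  refine ⟨⟨Or.inr (cN.memE t), fun hx => ⟨?_, cN.memE t⟩⟩, ?_, ?_⟩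
  · obtain ⟨u, _, hu⟩ := key hx
    rw [← hu]; exact cM.memE u
  · intro u hu
    have hu : cM.et u = cN.et t := hu
    have hh := ok.h2 _ (cN.memE t)
    have gg := ok.h1 _ (cM.memE u)
    rw [hu] at gg
    rcases hh.2 with h' | ⟨h', h3, h4⟩
    · omega
    · obtain ⟨u', hu', he⟩ := key h'
      rw [cM.et_inj (hu.trans he.symm)]; exact hu'
  · intro t' h
    rw [cN.et_inj h]; exact ht

theorem edgeSync_nontrivial (cM : Coded M P1 E1 a (b + 1)) (cN : Coded N P2 E2 b c)
    (ok : GlueOK m P1 P2 E1 E2 a b c) (e : Edge) (he : e ∈ glueE E1 E2 b) :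
    ¬ (edgeSync cM cN ok e he).Trivial := by
  rintro ⟨h1, h2⟩
  rcases he.1 with h | h
  · obtain ⟨t, ht⟩ := cM.exE h
    exact Set.notMem_empty t (h1 ▸ ht)
  · obtain ⟨t, ht⟩ := cN.exE h
    exact Set.notMem_empty t (h2 ▸ ht)

theorem edgeSync_minimal (cM : Coded M P1 E1 a (b + 1)) (cN : Coded N P2 E2 b c)
    (ok : GlueOK m P1 P2 E1 E2 a b c) (e : Edge) (he : e ∈ glueE E1 E2 b) :
    (edgeSync cM cN ok e he).Minimal := by
  refine ⟨edgeSync_nontrivial cM cN ok e he, fun s hU hV => ?_⟩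
  by_cases hu : s.U = ∅
  · by_cases hv : s.V = ∅
    · exact Or.inl ⟨hu, hv⟩
    · obtain ⟨t, ht⟩ := Set.nonempty_iff_ne_empty.2 hv
      have h := sync_ofV cM cN ok s t ht
      have hte : cN.et t = e := hV ht
      rw [hte] at h
      exact Or.inr ⟨hU.antisymm h.2.1, hV.antisymm h.2.2⟩
  · obtain ⟨t, ht⟩ := Set.nonempty_iff_ne_empty.2 hu
    have h := sync_ofU cM cN ok s t ht
    have hte : cM.et t = e := hU ht
    rw [hte] at h
    exact Or.inr ⟨hU.antisymm h.2.1, hV.antisymm h.2.2⟩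

theorem minimal_edge (cM : Coded M P1 E1 a (b + 1)) (cN : Coded N P2 E2 b c)
    (ok : GlueOK m P1 P2 E1 E2 a b c) (s : Sync M N) (hs : s.Minimal) :
    ∃ e, e ∈ glueE E1 E2 b ∧ s.U = {t | cM.et t = e} ∧ s.V = {u | cN.et u = e} := by
  have fin : ∀ e, e ∈ glueE E1 E2 b → {t' | cM.et t' = e} ⊆ s.U → {u | cN.et u = e} ⊆ s.V →
      ∃ e, e ∈ glueE E1 E2 b ∧ s.U = {t | cM.et t = e} ∧ s.V = {u | cN.et u = e} := by
    intro e he hU hV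
    rcases hs.2 (edgeSync cM cN ok e he) hU hV with h | h
    · exact absurd h (edgeSync_nontrivial cM cN ok e he)
    · exact ⟨e, he, h.1.symm, h.2.symm⟩
  by_cases hu : s.U = ∅
  · by_cases hv : s.V = ∅
    · exact absurd ⟨hu, hv⟩ hs.1
    · obtain ⟨t, ht⟩ := Set.nonempty_iff_ne_empty.2 hv
      have h := sync_ofV cM cN ok s t ht
      exact fin _ h.1 h.2.1 h.2.2
  · obtain ⟨t, ht⟩ := Set.nonempty_iff_ne_empty.2 hu
    have h := sync_ofU cM cN ok s t ht
    exact fin _ h.1 h.2.1 h.2.2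

theorem mem_inl_aux {α β : Type} (p : α) (A : Set α) (B : Set β) :
    (Sum.inl p : α ⊕ β) ∈ (Sum.inl '' A) ∪ (Sum.inr '' B) ↔ p ∈ A := by simp

theorem mem_inr_aux {α β : Type} (p : β) (A : Set α) (B : Set β) :
    (Sum.inr p : α ⊕ β) ∈ (Sum.inl '' A) ∪ (Sum.inr '' B) ↔ p ∈ B := by simp

theorem glue (cM : Coded M P1 E1 a (b + 1)) (cN : Coded N P2 E2 b c)
    (ok : GlueOK m P1 P2 E1 E2 a b c) :
    Nonempty (Coded (comp M N) (P1 ∪ P2) (glueE E1 E2 b) a c) := by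
  have hex : ∀ s : (comp M N).T, ∃ e, e ∈ glueE E1 E2 b ∧ s.1.U = {t | cM.et t = e} ∧
      s.1.V = {u | cN.et u = e} := fun s => minimal_edge cM cN ok s.1 s.2
  choose f hf hU hV using hex
  -- membership facts
  have hm1 : ∀ p, cM.ep p ∈ P1 := cM.memP
  have hm2 : ∀ p, cN.ep p ∈ P2 := cN.memP
  have ha := ok.ha
  have hc := ok.hc
  -- which side an edge is on
  have sideL : ∀ e ∈ glueE E1 E2 b, (e.1.1 ≤ b ∨ e.2.1 ≤ b) → ∃ t, cM.et t = e := by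
    intro e he h
    by_cases hx : Crossing b e
    · exact cM.exE (he.2 hx).1
    · rcases he.1 with h' | h'
      · exact cM.exE h'
      · rcases ok.h2 e h' with ⟨g1, g2 | g2⟩
        · omega
        · exact absurd g2.1 hx
  have sideR : ∀ e ∈ glueE E1 E2 b, (b + 1 ≤ e.1.1 ∨ b + 1 ≤ e.2.1) → ∃ t, cN.et t = e := by
    intro e he h
    by_cases hx : Crossing b e
    · exact cN.exE (he.2 hx).2
    · rcases he.1 with h' | h'
      · rcases ok.h1 e h' with ⟨g1, g2 | g2⟩
        · omega
        · exact absurd g2.1 hx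
      · exact cN.exE h'
  refine ⟨⟨Sum.elim cM.ep cN.ep, f, ?_, ?_, ?_, ?_, ?_, ?_, ?_, ?_, ?_⟩⟩
  · refine Function.Injective.sumElim cM.ep_inj cN.ep_inj fun p q h => ?_
    have h1 := ok.hP1 _ (hm1 p)
    have h2 := ok.hP2 _ (hm2 q)
    rw [h] at h1
    omega
  · intro s s' h
    apply Subtype.ext
    have h1 : s.1.U = s'.1.U := by rw [hU, hU, h]
    have h2 : s.1.V = s'.1.V := by rw [hV, hV, h]
    rcases s with ⟨⟨_, _, _, _, _⟩, _⟩
    rcases s' with ⟨⟨_, _, _, _, _⟩, _⟩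
    simp only at h1 h2
    subst h1 h2
    rfl
  · exact (Set.Sum.elim_range cM.ep cN.ep).trans (by rw [cM.ep_range, cN.ep_range])
  · ext e
    constructor
    · rintro ⟨s, rfl⟩
      exact hf s
    · intro he
      refine ⟨⟨edgeSync cM cN ok e he, edgeSync_minimal cM cN ok e he⟩, ?_⟩
      set s : (comp M N).T := ⟨edgeSync cM cN ok e he, edgeSync_minimal cM cN ok e he⟩
      rcases he.1 with h | h
      · obtain ⟨t, ht⟩ := cM.exE h
        have : t ∈ s.1.U := ht
        rw [hU] at this
        exact this.symm.trans ht
      · obtain ⟨t, ht⟩ := cN.exE h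
        have : t ∈ s.1.V := ht
        rw [hV] at this
        exact this.symm.trans ht
  · intro s p
    rcases p with p | p
    · refine (mem_inl_aux p _ _).trans ?_
      change p ∈ setPre M s.1.U ↔ cM.ep p = _
      rw [hU]
      simp only [setPre, Set.mem_iUnion, Set.mem_ofPred_eq, cM.pre_iff, exists_prop]
      constructor
      · rintro ⟨t, h, h'⟩; rw [h', h]
      · intro h
        obtain ⟨t, ht⟩ := sideL _ (hf s) (Or.inl (h ▸ ok.hP1 _ (hm1 p)))
        exact ⟨t, ht, by rw [h, ht]⟩
    · refine (mem_inr_aux p _ _).trans ?_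
      change p ∈ setPre N s.1.V ↔ cN.ep p = _
      rw [hV]
      simp only [setPre, Set.mem_iUnion, Set.mem_ofPred_eq, cN.pre_iff, exists_prop]
      constructor
      · rintro ⟨t, h, h'⟩; rw [h', h]
      · intro h
        obtain ⟨t, ht⟩ := sideR _ (hf s) (Or.inl (h ▸ ok.hP2 _ (hm2 p)))
        exact ⟨t, ht, by rw [h, ht]⟩
  · intro s p
    rcases p with p | p
    · refine (mem_inl_aux p _ _).trans ?_
      change p ∈ setPost M s.1.U ↔ cM.ep p = _
      rw [hU]
      simp only [setPost, Set.mem_iUnion, Set.mem_ofPred_eq, cM.post_iff, exists_prop]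
      constructor
      · rintro ⟨t, h, h'⟩; rw [h', h]
      · intro h
        obtain ⟨t, ht⟩ := sideL _ (hf s) (Or.inr (h ▸ ok.hP1 _ (hm1 p)))
        exact ⟨t, ht, by rw [h, ht]⟩
    · refine (mem_inr_aux p _ _).trans ?_
      change p ∈ setPost N s.1.V ↔ cN.ep p = _
      rw [hV]
      simp only [setPost, Set.mem_iUnion, Set.mem_ofPred_eq, cN.post_iff, exists_prop]
      constructor
      · rintro ⟨t, h, h'⟩; rw [h', h]
      · intro h
        obtain ⟨t, ht⟩ := sideR _ (hf s) (Or.inr (h ▸ ok.hP2 _ (hm2 p)))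
        exact ⟨t, ht, by rw [h, ht]⟩
  · intro s i
    change i ∈ setSrc M s.1.U ↔ _
    rw [hU]
    simp only [setSrc, Set.mem_iUnion, Set.mem_ofPred_eq, cM.src_iff, exists_prop]
    constructor
    · rintro ⟨t, h, h'⟩; rw [← h, h']
    · intro h
      obtain ⟨t, ht⟩ := sideL _ (hf s) (Or.inl (by rw [h]; exact ha))
      exact ⟨t, ht, by rw [ht, h]⟩
  · intro s i
    change i ∈ setTgt N s.1.V ↔ _
    rw [hV]
    simp only [setTgt, Set.mem_iUnion, Set.mem_ofPred_eq, cN.tgt_iff, exists_prop]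
    constructor
    · rintro ⟨t, h, h'⟩; rw [← h, h']
    · intro h
      obtain ⟨t, ht⟩ := sideR _ (hf s) (Or.inr (by rw [h]; exact hc))
      exact ⟨t, ht, by rw [ht, h]⟩
  · intro s s'
    change setCon M s.1.U s'.1.U ∨ setCon N s.1.V s'.1.V ↔ _
    rw [hU, hV, hU, hV]
    simp only [setCon, Set.mem_ofPred_eq, cM.con_iff, cN.con_iff]
    constructor
    · rintro (⟨t, ht, u, hu, h⟩ | ⟨t, ht, u, hu, h⟩)
      · rw [← ht, ← hu]; exact h
      · rw [← ht, ← hu]; exact h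
    · intro h
      have : ((∃ t, cM.et t = f s) ∧ (∃ t, cM.et t = f s')) ∨
          ((∃ t, cN.et t = f s) ∧ (∃ t, cN.et t = f s')) := by
        rcases h with h' | h'
        · rcases Nat.lt_or_ge b (f s).1.1 with g | g
          · exact Or.inr ⟨sideR _ (hf s) (Or.inl g), sideR _ (hf s') (Or.inl (h' ▸ g))⟩
          · exact Or.inl ⟨sideL _ (hf s) (Or.inl g), sideL _ (hf s') (Or.inl (h' ▸ g))⟩
        · rcases Nat.lt_or_ge b (f s).2.1 with g | g
          · exact Or.inr ⟨sideR _ (hf s) (Or.inr g), sideR _ (hf s') (Or.inr (h' ▸ g))⟩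
          · exact Or.inl ⟨sideL _ (hf s) (Or.inr g), sideL _ (hf s') (Or.inr (h' ▸ g))⟩
      rcases this with ⟨⟨t, ht⟩, ⟨u, hu⟩⟩ | ⟨⟨t, ht⟩, ⟨u, hu⟩⟩
      · exact Or.inl ⟨t, ht, u, hu, by rw [ht, hu]; exact h⟩
      · exact Or.inr ⟨t, ht, u, hu, by rw [ht, hu]; exact h⟩

end Glue

/-- Grid edges within columns `< n`. -/
def Adj (n : ℕ) (e : Edge) : Prop :=
  e.1.2 < n ∧ e.2.2 < n ∧
    ((e.2.1 = e.1.1 ∧ e.2.2 = e.1.2 + 1) ∨ (e.2.1 = e.1.1 + 1 ∧ e.2.2 = e.1.2))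

def partP (n m : ℕ) : Set Pt := {p | 1 ≤ p.1 ∧ p.1 ≤ m ∧ p.2 < n}
def partE (n m : ℕ) : Set Edge := {e | 1 ≤ e.1.1 ∧ e.1.1 ≤ m ∧ Adj n e}
def rowP (n b : ℕ) : Set Pt := {p | p.1 = b + 1 ∧ p.2 < n}
def rowE (n b : ℕ) : Set Edge :=
  {e | (e.1.1 = b + 1 ∨ (e.1.1 = b ∧ e.2.1 = b + 1)) ∧ Adj n e}
def fullE (n : ℕ) : Set Edge := {e | 1 ≤ e.1.1 ∧ e.2.1 ≤ n ∧ Adj n e}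

theorem rowP_finite (n b : ℕ) : (rowP n b).Finite := by
  refine (Set.finite_Iic ((b + 1, n) : Pt)).subset ?_
  rintro ⟨x, y⟩ ⟨h1, h2⟩
  simp only at h1 h2
  exact ⟨h1.le, h2.le⟩

theorem rowE_finite (n b : ℕ) : (rowE n b).Finite := by
  refine (Set.finite_Iic (((b + 2, n), (b + 2, n)) : Edge)).subset ?_
  rintro ⟨⟨x, y⟩, ⟨z, w⟩⟩ ⟨h1, h2, h3, h4⟩
  simp only at h1 h2 h3 h4
  simp only [Set.mem_Iic, Prod.mk_le_mk]
  omega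

def rowNet (n b : ℕ) : NetB n n :=
  codeNet n n (rowP n b) (rowE n b) (rowP_finite n b) (rowE_finite n b) b (b + 2)

def capNet (k l a b : ℕ) : NetB k l := codeNet k l ∅ ∅ Set.finite_empty Set.finite_empty a b

/-- The partial compositions. -/
def partNet (n : ℕ) : ℕ → NetB 0 n
  | 0 => capNet 0 n 0 1
  | m + 1 => comp (partNet n m) (rowNet n m)

theorem partNet_coded (n m : ℕ) :
    Nonempty (Coded (partNet n m) (partP n m) (partE n m) 0 (m + 1)) := by
  induction m with
  | zero =>
    have h1 : partP n 0 = ∅ := by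
      ext p; simp only [partP, Set.mem_ofPred_eq, Set.mem_empty_iff_false, iff_false]; omega
    have h2 : partE n 0 = ∅ := by
      ext p; simp only [partE, Set.mem_ofPred_eq, Set.mem_empty_iff_false, iff_false]; omega
    rw [h1, h2]
    exact ⟨codeNet_coded _ _ _ _ _ _ _ _⟩
  | succ m ih =>
    obtain ⟨c⟩ := ih
    have d : Coded (rowNet n m) (rowP n m) (rowE n m) m (m + 2) := codeNet_coded _ _ _ _ _ _ _ _
    have ok : GlueOK n (partP n m) (rowP n m) (partE n m) (rowE n m) 0 m (m + 2) := by
      refine ⟨by omega, by omega, ?_, ?_, ?_, ?_⟩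
      · rintro p ⟨h1, h2, h3⟩; exact h2
      · rintro p ⟨h1, h2⟩; exact h1.ge
      · rintro e ⟨h1, h2, h3, h4, h5⟩
        simp only [Crossing]; omega
      · rintro e ⟨h1, h3, h4, h5⟩
        simp only [Crossing]; omega
    have h1 : partP n (m + 1) = partP n m ∪ rowP n m := by
      ext p; simp only [partP, rowP, Set.mem_union, Set.mem_ofPred_eq]; omega
    have h2 : partE n (m + 1) = glueE (partE n m) (rowE n m) m := by
      ext e
      simp only [partE, rowE, glueE, Adj, Crossing, Set.mem_ofPred_eq]; omega
    rw [h1, h2]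
    exact glue c d ok

theorem final_coded (n : ℕ) :
    Nonempty (Coded (comp (partNet n n) (capNet n 0 n (n + 1))) (partP n n) (fullE n) 0 (n + 1)) := by
  obtain ⟨c⟩ := partNet_coded n n
  have d : Coded (capNet n 0 n (n + 1)) ∅ ∅ n (n + 1) := codeNet_coded _ _ _ _ _ _ _ _
  have ok : GlueOK n (partP n n) ∅ (partE n n) ∅ 0 n (n + 1) := by
    refine ⟨by omega, by omega, ?_, ?_, ?_, ?_⟩
    · rintro p ⟨h1, h2, h3⟩; exact h2
    · rintro p ⟨⟩
    · rintro e ⟨h1, h2, h3, h4, h5⟩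
      simp only [Crossing]; omega
    · rintro e ⟨⟩
  have h2 : fullE n = glueE (partE n n) ∅ n := by
    ext e
    simp only [partE, fullE, glueE, Adj, Crossing, Set.mem_ofPred_eq, Set.mem_empty_iff_false,
      or_false, and_false, imp_false]
    omega
  have := glue c d ok
  rw [Set.union_empty, ← h2] at this
  exact this

def gridCode {n : ℕ} (p : Fin n × Fin n) : Pt := ((p.1 : ℕ) + 1, (p.2 : ℕ))

theorem gridCode_inj {n : ℕ} : Function.Injective (gridCode (n := n)) := by
  rintro ⟨a, b⟩ ⟨c, d⟩ h
  simp only [gridCode, Prod.mk.injEq] at h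
  refine Prod.ext (Fin.ext ?_) (Fin.ext ?_)
  · simp only; omega
  · simp only; omega

def grid_coded (n : ℕ) : Coded (grid n) (partP n n) (fullE n) 0 (n + 1) where
  ep := gridCode
  et e := (gridCode e.1.1, gridCode e.1.2)
  ep_inj := gridCode_inj
  et_inj := by
    intro e f h
    simp only [Prod.mk.injEq] at h
    exact Subtype.ext (Prod.ext (gridCode_inj h.1) (gridCode_inj h.2))
  ep_range := by
    ext ⟨x, y⟩
    constructor
    · rintro ⟨⟨a, b⟩, h⟩
      simp only [gridCode, Prod.mk.injEq] at h
      simp only [partP, Set.mem_ofPred_eq]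
      omega
    · rintro ⟨h1, h2, h3⟩
      simp only at h1 h2 h3
      refine ⟨(⟨x - 1, by omega⟩, ⟨y, h3⟩), ?_⟩
      simp only [gridCode, Prod.mk.injEq, and_true]
      omega
  et_range := by
    ext ⟨⟨x, y⟩, ⟨z, w⟩⟩
    constructor
    · rintro ⟨⟨⟨⟨a, b⟩, ⟨c, d⟩⟩, h0⟩, h⟩
      simp only [gridCode, Prod.mk.injEq] at h
      simp only [Fin.ext_iff] at h0
      simp only [fullE, Adj, Set.mem_ofPred_eq]
      omega
    · rintro ⟨h1, h2, h3, h4, h5⟩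
      simp only at h1 h2 h3 h4 h5
      refine ⟨⟨((⟨x - 1, by omega⟩, ⟨y, h3⟩), (⟨z - 1, by omega⟩, ⟨w, h4⟩)), ?_⟩, ?_⟩
      · simp only [Fin.mk.injEq]; omega
      · simp only [gridCode, Prod.mk.injEq, and_true]; omega
  pre_iff t p := by
    change p = t.1.1 ↔ _
    exact gridCode_inj.eq_iff.symm
  post_iff t p := by
    change p = t.1.2 ↔ _
    exact gridCode_inj.eq_iff.symm
  src_iff _ i := i.elim0
  tgt_iff _ i := i.elim0
  con_iff t u := by
    change (t.1.1 = u.1.1 ∨ t.1.2 = u.1.2) ↔ _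
    simp only [Share, gridCode_inj.eq_iff]

/-- The assignment. -/
def asg (n : ℕ) : ℕ ⊕ Bool → NetS
  | .inl b => ⟨n, n, rowNet n b⟩
  | .inr false => ⟨0, n, capNet 0 n 0 1⟩
  | .inr true => ⟨n, 0, capNet n 0 n (n + 1)⟩

def pexpr : ℕ → WExpr (ℕ ⊕ Bool)
  | 0 => .leaf (.inr false)
  | m + 1 => .seq (pexpr m) (.leaf (.inl m))

theorem castNet_rfl {k l : ℕ} (h1 : k = k) (h2 : l = l) (N : NetB k l) : castNet h1 h2 N = N := by
  cases N
  simp [castNet]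

theorem seqS_mk {a b c : ℕ} (M : NetB a b) (N : NetB b c) :
    seqS ⟨a, b, M⟩ ⟨b, c, N⟩ = ⟨a, c, comp M N⟩ := by
  simp only [seqS, castNet_rfl]
  exact dif_pos rfl

theorem sem_pexpr (n m : ℕ) : sem (asg n) (pexpr m) = ⟨0, n, partNet n m⟩ := by
  induction m with
  | zero => rfl
  | succ m ih =>
    simp only [pexpr, sem, ih]
    exact seqS_mk _ _

theorem pure_aux (X Y : NetS) {a b c : ℕ} (M : NetB a b) (N : NetB b c) (hX : X = ⟨a, b, M⟩)
    (hY : Y = ⟨b, c, N⟩) (hp : Pure M N) (h : X.2.1 = Y.1) :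
    Pure (castNet rfl h X.2.2) Y.2.2 := by
  subst hX hY
  rw [castNet_rfl]
  exact hp

theorem iso_aux (X : NetS) {a b : ℕ} (M N : NetB a b) (hX : X = ⟨a, b, M⟩) (hi : Iso M N) :
    ∃ (h1 : X.1 = a) (h2 : X.2.1 = b), Iso (castNet h1 h2 X.2.2) N := by
  subst hX
  refine ⟨rfl, rfl, ?_⟩
  rw [castNet_rfl]
  exact hi

theorem asg_contention (n : ℕ) : ∀ x, IsContention (asg n x).2.2 := by
  rintro (b | _ | _)
  · exact (codeNet_coded _ _ _ _ _ _ _ _).isContention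
  · exact (codeNet_coded _ _ _ _ _ _ _ _).isContention
  · exact (codeNet_coded _ _ _ _ _ _ _ _).isContention

theorem rowNet_card (n b : ℕ) : Nat.card (rowNet n b).P ≤ n := by
  have : Nat.card (rowNet n b).P ≤ Nat.card (Fin n) := by
    refine Nat.card_le_card_of_injective
      (fun p : ↥(rowP n b) => (⟨p.1.2, p.2.2⟩ : Fin n)) ?_
    intro p q h
    have h' : p.1.2 = q.1.2 := by simpa using h
    exact Subtype.ext (Prod.ext (p.2.1.trans q.2.1.symm) h')
  simpa using this

theorem capNet_card (k l a b n : ℕ) : Nat.card (capNet k l a b).P ≤ n := by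
  change Nat.card (↥(∅ : Set Pt)) ≤ n
  simp

theorem pexpr_props (n m : ℕ) : WT (asg n) (pexpr m) ∧ HasWidth (asg n) n (pexpr m) ∧
    PureExpr (asg n) (pexpr m) := by
  induction m with
  | zero => exact ⟨trivial, ⟨Nat.zero_le _, capNet_card _ _ _ _ _, le_rfl⟩, trivial⟩
  | succ m ih =>
    obtain ⟨h1, h2, h3⟩ := ih
    refine ⟨⟨h1, trivial, ?_⟩, ⟨h2, ⟨le_rfl, rowNet_card n m, le_rfl⟩, ?_, ?_⟩, ⟨h3, trivial, ?_⟩⟩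
    · rw [sem_pexpr]; rfl
    · change (sem (asg n) (pexpr (m + 1))).1 ≤ n
      rw [sem_pexpr]; exact Nat.zero_le _
    · change (sem (asg n) (pexpr (m + 1))).2.1 ≤ n
      rw [sem_pexpr]
    · obtain ⟨c⟩ := partNet_coded n m
      exact pure_aux _ _ (partNet n m) (rowNet n m) (sem_pexpr n m) rfl
        (c.pure (codeNet_coded _ _ _ _ _ _ _ _))

/-- for every `n ≥ 1`, the grid net `G_n` has a pure wiring
decomposition of width `n`. -/
theorem grid_pure_decompWidth (n : ℕ) (hn : 1 ≤ n) :
    ∃ (Var : Type) (A : Var → NetS) (t : WExpr Var),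
      IsDecompOf A t (grid n) ∧ HasWidth A n t ∧ PureExpr A t := by
  have hs : sem (asg n) (.seq (pexpr n) (.leaf (.inr true))) =
      ⟨0, 0, comp (partNet n n) (capNet n 0 n (n + 1))⟩ := by
    simp only [sem, sem_pexpr]
    exact seqS_mk _ _
  obtain ⟨h1, h2, h3⟩ := pexpr_props n n
  refine ⟨ℕ ⊕ Bool, asg n, .seq (pexpr n) (.leaf (.inr true)), ⟨asg_contention n, ?_, ?_⟩, ?_, ?_⟩
  · refine ⟨h1, trivial, ?_⟩
    rw [sem_pexpr]; rfl
  · obtain ⟨c⟩ := final_coded n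
    exact iso_aux _ _ _ hs (c.iso (grid_coded n))
  · refine ⟨h2, ⟨le_rfl, capNet_card _ _ _ _ _, Nat.zero_le _⟩, ?_, ?_⟩
    · rw [hs]; exact Nat.zero_le _
    · rw [hs]; exact Nat.zero_le _
  · refine ⟨h3, trivial, ?_⟩
    obtain ⟨c⟩ := partNet_coded n n
    exact pure_aux _ _ (partNet n n) (capNet n 0 n (n + 1)) (sem_pexpr n n) rfl
      (c.pure (codeNet_coded _ _ _ _ _ _ _ _))

end NWB
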